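/- Let N be a natural number and let λ, λ' be locations in Δ_N. Then ∂(λ,λ') ≤ N. Moreover ∂(λ,λ') = N if and only if there exists η ∈ {1,2,3} such that one of λ, λ' has η-coordinate N (i.e., is the η-corner of Δ_N) and the other has η-coordinate 0 (i.e., lies on the η-boundary of Δ_N). -/

import Mathlib

/-- `Δ_N`: the set of triples of natural numbers with sum `N`. -/
def BA.Delta (N : ℕ) : Set (Fin 3 → ℕ) := {v | v 0 + v 1 + v 2 = N}

/-- Adjacency: `u - v = e_i - e_j` (computed in `ℤ³`) for some `i ≠ j`. -/
def BA.Adj (u v : Fin 3 → ℕ) : Prop :=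
  ∃ i j : Fin 3, i ≠ j ∧ ∀ k, (u k : ℤ) - (v k : ℤ) =
    (if k = i then 1 else 0) - (if k = j then 1 else 0)

/-- A walk of length `n` in `Δ_N` from `u` to `v`. -/
def BA.IsWalk (N n : ℕ) (f : ℕ → Fin 3 → ℕ) (u v : Fin 3 → ℕ) : Prop :=
  f 0 = u ∧ f n = v ∧ (∀ i ≤ n, f i ∈ BA.Delta N) ∧ ∀ i < n, BA.Adj (f i) (f (i + 1))

/-- The graph distance on `Δ_N`: the least length of a walk from `u` to `v`. -/
noncomputable def BA.dist (N : ℕ) (u v : Fin 3 → ℕ) : ℕ :=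
  sInf {n | ∃ f : ℕ → Fin 3 → ℕ, BA.IsWalk N n f u v}

theorem BA.Adj.abs_sub_le {u v : Fin 3 → ℕ} (h : BA.Adj u v) (k : Fin 3) :
    |(u k : ℤ) - v k| ≤ 1 := by
  obtain ⟨i, j, -, h⟩ := h
  rw [h k, abs_le]
  split_ifs <;> omega

theorem BA.IsWalk.abs_sub_le {N n : ℕ} {f : ℕ → Fin 3 → ℕ} {u v : Fin 3 → ℕ}
    (h : BA.IsWalk N n f u v) (k : Fin 3) : |(u k : ℤ) - v k| ≤ n := by
  obtain ⟨rfl, rfl, -, hadj⟩ := h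
  have key : ∀ m ≤ n, |(f 0 k : ℤ) - f m k| ≤ m := by
    intro m hm
    induction m with
    | zero => simp
    | succ m ih =>
      have h₁ := ih (by omega)
      have h₂ := (hadj m (by omega)).abs_sub_le k
      rw [abs_le] at h₁ h₂ ⊢
      omega
  exact key n le_rfl

theorem BA.IsWalk.cons {N n : ℕ} {f : ℕ → Fin 3 → ℕ} {u w v : Fin 3 → ℕ}
    (hu : u ∈ BA.Delta N) (huw : BA.Adj u w) (h : BA.IsWalk N n f w v) :
    BA.IsWalk N (n + 1) (fun i => Nat.casesOn i u f) u v := by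
  obtain ⟨rfl, rfl, hmem, hadj⟩ := h
  refine ⟨rfl, rfl, ?_, ?_⟩
  · rintro (_ | i) hi
    · exact hu
    · exact hmem i (by omega)
  · rintro (_ | i) hi
    · exact huw
    · exact hadj i (by omega)

/-- A location adjacent to `u` that is one step closer to `v` in the sup metric. -/
theorem BA.exists_adj_abs_sub_le {N n : ℕ} {u v : Fin 3 → ℕ}
    (hu : u ∈ BA.Delta N) (hv : v ∈ BA.Delta N) (huv : u ≠ v)
    (h : ∀ k, |(u k : ℤ) - v k| ≤ n + 1) :
    ∃ w ∈ BA.Delta N, BA.Adj u w ∧ ∀ k, |(w k : ℤ) - v k| ≤ n := by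
  obtain ⟨i, hi⟩ := Finite.exists_max fun k => (u k : ℤ) - v k
  obtain ⟨j, hj⟩ := Finite.exists_min fun k => (u k : ℤ) - v k
  have hne : ¬(u 0 = v 0 ∧ u 1 = v 1 ∧ u 2 = v 2) := by
    rintro ⟨h₀, h₁, h₂⟩
    exact huv (funext (by simp [Fin.forall_fin_succ, h₀, h₁, h₂]))
  simp only [BA.Delta, Set.mem_ofPred_eq] at hu hv
  simp only [abs_le, Fin.forall_fin_succ, Fin.isValue, Fin.succ_zero_eq_one,
    Fin.succ_one_eq_two, IsEmpty.forall_iff, and_true] at hi hj h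
  refine ⟨fun k => u k + (if k = j then 1 else 0) - (if k = i then 1 else 0), ?_,
    ⟨i, j, ?_, ?_⟩, ?_⟩
  all_goals
    simp only [BA.Delta, Set.mem_ofPred_eq, ne_eq, abs_le, Fin.forall_fin_succ, Fin.isValue,
      Fin.succ_zero_eq_one, Fin.succ_one_eq_two, IsEmpty.forall_iff, and_true]
    fin_cases i <;> fin_cases j <;> simp at hi hj ⊢ <;> omega

theorem BA.exists_isWalk_le {N : ℕ} (n : ℕ) {u v : Fin 3 → ℕ}
    (hu : u ∈ BA.Delta N) (hv : v ∈ BA.Delta N) (h : ∀ k, |(u k : ℤ) - v k| ≤ n) :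
    ∃ m ≤ n, ∃ f, BA.IsWalk N m f u v := by
  induction n generalizing u with
  | zero =>
    have huv : u = v := funext fun k => by
      have := abs_le.1 (h k)
      omega
    exact ⟨0, le_rfl, fun _ => u, rfl, huv, fun _ _ => hu, by simp⟩
  | succ n ih =>
    by_cases huv : u = v
    · exact ⟨0, Nat.zero_le _, fun _ => u, rfl, huv, fun _ _ => hu, by simp⟩
    · obtain ⟨w, hw, huw, hwv⟩ :=
        BA.exists_adj_abs_sub_le (n := n) hu hv huv (by exact_mod_cast h)
      obtain ⟨m, hm, f, hf⟩ := ih hw hwv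
      exact ⟨m + 1, by omega, _, hf.cons hu huw⟩

theorem BA.dist_le_iff {N n : ℕ} {u v : Fin 3 → ℕ}
    (hu : u ∈ BA.Delta N) (hv : v ∈ BA.Delta N) :
    BA.dist N u v ≤ n ↔ ∀ k, |(u k : ℤ) - v k| ≤ n := by
  constructor
  · intro hn k
    have hN : ∀ k, |(u k : ℤ) - v k| ≤ N := by
      simp only [BA.Delta, Set.mem_ofPred_eq] at hu hv
      simp only [abs_le, Fin.forall_fin_succ, Fin.isValue, Fin.succ_zero_eq_one,
        Fin.succ_one_eq_two, IsEmpty.forall_iff, and_true]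
      omega
    obtain ⟨m, -, hm⟩ := BA.exists_isWalk_le N hu hv hN
    obtain ⟨f, hf⟩ :=
      Nat.sInf_mem (s := {n | ∃ f : ℕ → Fin 3 → ℕ, BA.IsWalk N n f u v}) ⟨m, hm⟩
    exact (hf.abs_sub_le k).trans (by exact_mod_cast hn)
  · intro h
    obtain ⟨m, hmn, hm⟩ := BA.exists_isWalk_le n hu hv h
    exact (Nat.sInf_le hm).trans hmn

/-- For locations `λ, λ'` of `Δ_N` we have `∂(λ,λ') ≤ N`, with equality iff
there exists `η ∈ {1,2,3}` such that one of `λ, λ'` has `η`-coordinate `N`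
(is the `η`-corner) and the other has `η`-coordinate `0` (is on the
`η`-boundary). -/
theorem stmt2 (N : ℕ) (l l' : Fin 3 → ℕ)
    (hl : l ∈ BA.Delta N) (hl' : l' ∈ BA.Delta N) :
    BA.dist N l l' ≤ N ∧
      (BA.dist N l l' = N ↔
        ∃ η : Fin 3, (l η = N ∧ l' η = 0) ∨ (l' η = N ∧ l η = 0)) := by
  have hiff := fun n => BA.dist_le_iff (n := n) hl hl'
  simp only [BA.Delta, Set.mem_ofPred_eq] at hl hl'
  simp only [abs_le, Fin.forall_fin_succ, Fin.exists_fin_succ, Fin.isValue,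
    Fin.succ_zero_eq_one, Fin.succ_one_eq_two, IsEmpty.forall_iff, IsEmpty.exists_iff,
    and_true, or_false] at hiff ⊢
  have hle : BA.dist N l l' ≤ N := (hiff N).2 (by omega)
  have hpred := hiff (N - 1)
  exact ⟨hle, by omega⟩
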